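/- arXiv:math/0509136 — 7 statements merged into one kernel-verified Lean document; each statement's English description precedes it below -/
import Mathlib

section
/- For every finite partially ordered set P there exist (necessarily unique) polynomials Ω(P,X) and Ω̄(P,X) in ℚ[X] such that for every positive integer n, the value of Ω(P,X) at n equals the number of order-preserving maps P → Fin n and the value of Ω̄(P,X) at n equals the number of strictly order-preserving maps P → Fin n. -/
/-- Number of order-preserving maps `P → Fin n`. -/
noncomputable def orderCount (P : Type*) [PartialOrder P] (n : ℕ) : ℕ :=
  Nat.card {f : P → Fin n // Monotone f}

/-- Number of strictly order-preserving maps `P → Fin n`. -/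
noncomputable def strictCount (P : Type*) [PartialOrder P] (n : ℕ) : ℕ :=
  Nat.card {f : P → Fin n // StrictMono f}

/-- `p` is an order polynomial of `P`. -/
def IsOrderPoly (P : Type*) [PartialOrder P] (p : Polynomial ℚ) : Prop :=
  ∀ n : ℕ, 0 < n → p.eval (n : ℚ) = orderCount P n

/-- `q` is a strict order polynomial of `P`. -/
def IsStrictOrderPoly (P : Type*) [PartialOrder P] (q : Polynomial ℚ) : Prop :=
  ∀ n : ℕ, 0 < n → q.eval (n : ℚ) = strictCount P n

/-- Every map `P → Fin n` factors uniquely as a surjection onto some `Fin k` followed by an order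
embedding `Fin k ↪o Fin n`. -/
theorem bijective_orderEmbedding_comp {P : Type*} [Fintype P] (n : ℕ)
    (Q : ∀ n : ℕ, (P → Fin n) → Prop)
    (hQ : ∀ (k n : ℕ) (e : Fin k ↪o Fin n) (g : P → Fin k), Q n (e ∘ g) ↔ Q k g) :
    Function.Bijective
      (fun x : Σ k : Fin (Fintype.card P + 1),
          (Fin k ↪o Fin n) × {g : P → Fin k // Q k g ∧ Function.Surjective g} =>
        (⟨x.2.1 ∘ x.2.2.1, (hQ _ _ _ _).2 x.2.2.2.1⟩ : {f : P → Fin n // Q n f})) := by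
  classical
  constructor
  · rintro ⟨⟨k, hk⟩, e, g, hg, hgs⟩ ⟨⟨k', hk'⟩, e', g', hg', hgs'⟩ h
    have hcomp : e ∘ g = e' ∘ g' := congrArg Subtype.val h
    have hrange : Set.range e = Set.range e' := by
      rw [← hgs.range_comp, ← hgs'.range_comp, hcomp]
    obtain rfl : k = k' := by
      have := congrArg Set.ncard hrange
      simpa [← Set.image_univ, Set.ncard_image_of_injective _ e.injective,
        Set.ncard_image_of_injective _ e'.injective] using this
    obtain rfl : e = e' := DFunLike.coe_injective ((e.strictMono.range_inj e'.strictMono).1 hrange)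
    obtain rfl : g = g' := e.injective.comp_left hcomp
    rfl
  · rintro ⟨f, hf⟩
    let e := (Finset.univ.image f).orderEmbOfFin rfl
    have he (p : P) : ∃ i, e i = f p := by
      have : f p ∈ Set.range e := by simp [e]
      exact this
    choose g hg using he
    have hcomp : e ∘ g = f := funext hg
    refine ⟨⟨⟨_, Nat.lt_succ_of_le Finset.card_image_le⟩, e, g, ?_, fun i => ?_⟩,
      Subtype.ext hcomp⟩
    · rw [← hQ _ _ e, hcomp]
      exact hf
    · have hi : e i ∈ Finset.univ.image f := Finset.orderEmbOfFin_mem _ _ i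
      obtain ⟨p, -, hp⟩ := Finset.mem_image.1 hi
      exact ⟨p, e.injective ((hg p).trans hp)⟩

theorem card_fin_orderEmbedding (k n : ℕ) : Nat.card (Fin k ↪o Fin n) = n.choose k := by
  rw [Nat.card_congr Set.powersetCard.ofFinEmbEquiv, Set.powersetCard.card, Nat.card_fin]

/-- A family of conditions on maps `P → Fin n` that is invariant under order embeddings is
satisfied by a number of maps that is polynomial in `n`. -/
theorem exists_polynomial_eval_eq_card {P : Type*} [Fintype P]
    (Q : ∀ n : ℕ, (P → Fin n) → Prop)
    (hQ : ∀ (k n : ℕ) (e : Fin k ↪o Fin n) (g : P → Fin k), Q n (e ∘ g) ↔ Q k g) :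
    ∃ p : Polynomial ℚ, ∀ n : ℕ, p.eval (n : ℚ) = Nat.card {f : P → Fin n // Q n f} := by
  refine ⟨∑ k : Fin (Fintype.card P + 1), descPochhammer ℚ k *
    Polynomial.C ((Nat.card {g : P → Fin k // Q k g ∧ Function.Surjective g} : ℚ) /
      (k : ℕ).factorial), fun n => ?_⟩
  rw [← Nat.card_congr (Equiv.ofBijective _ (bijective_orderEmbedding_comp n Q hQ)),
    Nat.card_sigma, Polynomial.eval_finsetSum, Nat.cast_sum]
  refine Finset.sum_congr rfl fun k _ => ?_
  rw [Nat.card_prod, card_fin_orderEmbedding, Polynomial.eval_mul, Polynomial.eval_C,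
    Nat.cast_mul, Nat.cast_choose_eq_descPochhammer_div]
  ring


/-- Every finite poset has an order polynomial and a strict order
polynomial. -/
theorem exists_orderPoly_and_strictOrderPoly (P : Type*) [Fintype P] [PartialOrder P] :
    (∃ p : Polynomial ℚ, IsOrderPoly P p) ∧ (∃ q : Polynomial ℚ, IsStrictOrderPoly P q) := by
  obtain ⟨p, hp⟩ := exists_polynomial_eval_eq_card (P := P) (fun _ f => Monotone f)
    fun _ _ e _ => by simp [Monotone]
  obtain ⟨q, hq⟩ := exists_polynomial_eval_eq_card (P := P) (fun _ f => StrictMono f)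
    fun _ _ e _ => by simp [StrictMono]
  exact ⟨⟨p, fun n _ => hp n⟩, ⟨q, fun n _ => hq n⟩⟩
end

section
/- (Reciprocity Relation.) Let P be a finite poset with |P| elements. If p ∈ ℚ[X] is an order polynomial of P and q ∈ ℚ[X] is a strict order polynomial of P, then p(X) = (−1)^{|P|} · q(−X) as polynomials in ℚ[X]. -/
namespace OrderPoly

open Finset Polynomial

/-- Every rational polynomial has a polynomial antidifference with prescribed value at `0`. -/
lemma exists_antidifference (g : ℚ[X]) (c : ℚ) :
    ∃ G : ℚ[X], G.eval 0 = c ∧ ∀ x, G.eval (x + 1) = G.eval x + g.eval x := by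
  suffices h : ∃ G : ℚ[X], ∀ x, G.eval (x + 1) = G.eval x + g.eval x by
    obtain ⟨G, hG⟩ := h
    exact ⟨G + C (c - G.eval 0), by simp, fun x => by simp [hG]; ring⟩
  induction g using Polynomial.induction_on' with
  | add a b ha hb =>
    obtain ⟨A, hA⟩ := ha
    obtain ⟨B, hB⟩ := hb
    exact ⟨A + B, fun x => by simp [hA, hB]; ring⟩
  | monomial k a =>
    refine ⟨C (a / (k + 1)) * Polynomial.bernoulli (k + 1), fun x => ?_⟩
    have hk : (k + 1 : ℚ) ≠ 0 := by positivity
    rw [add_comm x 1]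
    simp only [eval_mul, eval_C, eval_monomial, Polynomial.bernoulli_eval_one_add]
    push_cast
    field_simp

lemma eq_of_eval_natCast_succ {p q : ℚ[X]}
    (h : ∀ n : ℕ, p.eval ((n : ℚ) + 1) = q.eval ((n : ℚ) + 1)) : p = q := by
  refine Polynomial.eq_of_infinite_eval_eq p q
    ((Set.infinite_range_of_injective (f := fun n : ℕ => (n : ℚ) + 1) ?_).mono ?_)
  · intro a b hab
    simpa using hab
  · rintro _ ⟨n, rfl⟩
    exact h n

variable {P : Type*} [Fintype P] [PartialOrder P]

open scoped Classical in
/-- Maps `s → {0, …, n - 1}`, extended by the value `n` outside `s`, that are order-preserving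
(`b = 0`) or strictly order-preserving (`b = 1`) on `s`. -/
noncomputable def maps (b : ℕ) (s : Finset P) (n : ℕ) : Finset (P → ℕ) :=
  {f ∈ Fintype.piFinset fun x => if x ∈ s then range n else {n} |
    ∀ x ∈ s, ∀ y ∈ s, x < y → f x + b ≤ f y}

lemma mem_maps {b : ℕ} {s : Finset P} {n : ℕ} {f : P → ℕ} :
    f ∈ maps b s n ↔ (∀ x ∈ s, f x < n) ∧ (∀ x ∉ s, f x = n) ∧
      ∀ x ∈ s, ∀ y ∈ s, x < y → f x + b ≤ f y := by
  simp only [maps, mem_filter, Fintype.mem_piFinset, ← and_assoc]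
  refine and_congr_left fun _ => ⟨fun h => ⟨fun x hx => ?_, fun x hx => ?_⟩, fun h x => ?_⟩
  · simpa [hx] using h x
  · simpa [hx] using h x
  · by_cases hx : x ∈ s
    · simpa [hx] using h.1 x hx
    · simpa [hx] using h.2 x hx

open scoped Classical in
/-- The sets obtained from `s` by deleting the top fibre of a map in `maps b s n`. -/
noncomputable def truncations (b : ℕ) (s : Finset P) : Finset (Finset P) :=
  {t ∈ s.powerset | ∀ x ∈ s, ∀ y ∈ s, x < y → y ∈ t ∨ b = 1 → x ∈ t}

lemma mem_truncations {b : ℕ} {s t : Finset P} :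
    t ∈ truncations b s ↔
      t ⊆ s ∧ ∀ x ∈ s, ∀ y ∈ s, x < y → y ∈ t ∨ b = 1 → x ∈ t := by
  simp [truncations]

lemma card_maps_succ {b : ℕ} (hb : b ≤ 1) (s : Finset P) (n : ℕ) :
    #(maps b s (n + 1)) = ∑ t ∈ truncations b s, #(maps b t n) := by
  classical
  rw [card_eq_sum_card_fiberwise (f := fun f => s.filter (f · < n)) (t := truncations b s)]
  · refine sum_congr rfl fun t ht => ?_
    rw [mem_truncations] at ht
    obtain ⟨hts, ht⟩ := ht
    refine card_nbij' (fun f x => min (f x) n) (fun g x => if x ∈ s then g x else n + 1)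
      ?_ ?_ ?_ ?_
    · intro f hf
      simp only [coe_filter, Set.mem_ofPred_eq, mem_maps] at hf
      obtain ⟨⟨h1, h2, h3⟩, rfl⟩ := hf
      simp only [mem_coe, mem_maps]
      refine ⟨?_, ?_, ?_⟩ <;> grind
    · intro g hg
      simp only [mem_coe, mem_maps] at hg
      obtain ⟨h1, h2, h3⟩ := hg
      simp only [coe_filter, Set.mem_ofPred_eq, mem_maps]
      refine ⟨⟨?_, ?_, ?_⟩, ?_⟩
      · grind
      · grind
      · intro x hx y hy hxy
        have := ht x hx y hy hxy
        by_cases hxt : x ∈ t <;> by_cases hyt : y ∈ t <;> grind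
      · ext x
        grind
    · intro f hf
      simp only [coe_filter, Set.mem_ofPred_eq, mem_maps] at hf
      obtain ⟨⟨h1, h2, h3⟩, -⟩ := hf
      funext x
      grind
    · intro g hg
      simp only [mem_coe, mem_maps] at hg
      obtain ⟨h1, h2, h3⟩ := hg
      funext x
      grind
  · intro f hf
    simp only [mem_coe, mem_maps] at hf
    obtain ⟨h1, h2, h3⟩ := hf
    simp only [mem_coe, mem_truncations]
    refine ⟨filter_subset _ _, fun x hx y hy hxy h => ?_⟩
    have := h3 x hx y hy hxy
    have := h1 y hy
    grind

open scoped Classical in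
lemma card_maps_zero (b : ℕ) (s : Finset P) : #(maps b s 0) = if s = ∅ then 1 else 0 := by
  split_ifs with h
  · subst h
    rw [card_eq_one]
    refine ⟨fun _ => 0, ?_⟩
    ext f
    simp [mem_maps, funext_iff]
  · obtain ⟨x, hx⟩ := nonempty_iff_ne_empty.2 h
    rw [card_eq_zero, eq_empty_iff_forall_notMem]
    intro f hf
    exact absurd ((mem_maps.1 hf).1 x hx) (Nat.not_lt_zero _)

lemma self_mem_truncations_zero (s : Finset P) : s ∈ truncations 0 s :=
  mem_truncations.2 ⟨Subset.rfl, fun _ hx _ _ _ _ => hx⟩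

lemma exists_poly_card_maps (s : Finset P) :
    ∃ p : ℚ[X], ∀ n : ℕ, p.eval (n : ℚ) = #(maps 0 s n) := by
  classical
  induction s using Finset.strongInduction with
  | H s ih =>
    choose! p hp using ih
    obtain ⟨G, hG0, hG⟩ := exists_antidifference
      (∑ t ∈ (truncations 0 s).erase s, p t) (#(maps 0 s 0))
    refine ⟨G, fun n => ?_⟩
    induction n with
    | zero => simpa using hG0
    | succ n ihn =>
      rw [Nat.cast_succ, hG, ihn, card_maps_succ zero_le_one,
        ← add_sum_erase _ _ (self_mem_truncations_zero s), eval_finsetSum]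
      push_cast
      congr 1
      refine sum_congr rfl fun t ht => hp t ?_ n
      rw [mem_erase, mem_truncations] at ht
      exact ht.2.1.ssubset_of_ne ht.1

lemma sum_truncations_sign [DecidableEq P] {s u : Finset P} (hu : u ∈ truncations 0 s) :
    ∑ t ∈ truncations 1 s with u ⊆ t, (-1 : ℚ) ^ #(s \ t) = if u = s then 1 else 0 := by
  classical
  rw [mem_truncations] at hu
  set M : Finset P := {x ∈ s \ u | ∀ y ∈ s, ¬ x < y} with hM
  have key : ∑ t ∈ truncations 1 s with u ⊆ t, (-1 : ℚ) ^ #(s \ t) =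
      ∑ S ∈ M.powerset, (-1 : ℚ) ^ #S := by
    refine sum_nbij' (s \ ·) (s \ ·) ?_ ?_ ?_ ?_ ?_
    · intro t ht
      simp only [mem_filter, mem_truncations] at ht
      grind
    · intro S hS
      simp only [mem_filter, mem_truncations]
      grind
    · intro t ht
      simp only [mem_filter, mem_truncations] at ht
      exact Finset.sdiff_sdiff_eq_self ht.1.1
    · intro S hS
      exact Finset.sdiff_sdiff_eq_self (by grind)
    · intros
      rfl
  rw [key]
  split_ifs with h
  · have : M = ∅ := by grind
    simp [this]
  · obtain ⟨x, hx⟩ : (s \ u).Nonempty := by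
      rw [sdiff_nonempty]
      exact fun hsu => h (hu.1.antisymm hsu)
    obtain ⟨m, hm⟩ := (s \ u).exists_maximal ⟨x, hx⟩
    have hmM : m ∈ M := by
      refine mem_filter.2 ⟨hm.prop, fun y hy hmy => ?_⟩
      have hmem := mem_sdiff.1 hm.prop
      by_cases hyu : y ∈ u
      · exact hmem.2 (hu.2 m hmem.1 y hy hmy (Or.inl hyu))
      · exact hm.not_gt (mem_sdiff.2 ⟨hy, hyu⟩) hmy
    have := Finset.sum_powerset_neg_one_pow_card_of_nonempty ⟨m, hmM⟩
    exact_mod_cast this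

lemma card_maps_zero_eq_sum [DecidableEq P] (s : Finset P) (n : ℕ) :
    (#(maps 0 s n) : ℚ) =
      ∑ t ∈ truncations 1 s, (-1 : ℚ) ^ #(s \ t) * #(maps 0 t (n + 1)) := by
  classical
  simp_rw [card_maps_succ zero_le_one, Nat.cast_sum, mul_sum]
  rw [sum_comm' (t' := truncations 0 s) (s' := fun u => {t ∈ truncations 1 s | u ⊆ t})]
  · simp_rw [← sum_mul]
    rw [sum_congr rfl fun u hu => by rw [sum_truncations_sign hu]]
    simp [self_mem_truncations_zero]
  · intro t u
    simp only [mem_filter, mem_truncations]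
    grind

lemma eval_neg_eq_card_maps {p : Finset P → ℚ[X]}
    (hp : ∀ s (n : ℕ), (p s).eval (n : ℚ) = #(maps 0 s n)) (n : ℕ) (s : Finset P) :
    (p s).eval (-n : ℚ) = (-1) ^ #s * #(maps 1 s n) := by
  classical
  have rec_p (s) : p s =
      ∑ t ∈ truncations 1 s, C ((-1 : ℚ) ^ #(s \ t)) * (p t).comp (X + 1) := by
    refine eq_of_eval_natCast_succ fun n => ?_
    have h := card_maps_zero_eq_sum s (n + 1)
    simp only [← hp] at h
    push_cast at h
    simpa [eval_finsetSum] using h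
  induction n generalizing s with
  | zero =>
    have h := hp s 0
    rw [Nat.cast_zero, card_maps_zero] at h
    rw [Nat.cast_zero, neg_zero, h, card_maps_zero]
    split_ifs with hs <;> simp [hs]
  | succ n ih =>
    rw [rec_p, eval_finsetSum, card_maps_succ le_rfl, Nat.cast_sum, mul_sum]
    refine sum_congr rfl fun t ht => ?_
    have hts := (mem_truncations.1 ht).1
    have : (-((n + 1 : ℕ) : ℚ) + 1) = -n := by push_cast; ring
    simp only [eval_mul, eval_C, eval_comp, eval_add, eval_X, eval_one, this, ih]
    rw [← mul_assoc, ← pow_add, card_sdiff_add_card_eq_card hts]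

lemma natCard_eq_card_maps (b n : ℕ) (Q : (P → Fin n) → Prop)
    (hQ : ∀ f, Q f ↔ ∀ x y, x < y → (f x : ℕ) + b ≤ f y) :
    Nat.card {f // Q f} = #(maps b (univ : Finset P) n) := by
  rw [← Nat.card_eq_finsetCard]
  refine Nat.card_congr
    { toFun := fun f => ⟨fun x => f.1 x, mem_maps.2 ⟨by simp, by simp, by simpa using (hQ _).1 f.2⟩⟩
      invFun := fun f => ⟨fun x => ⟨f.1 x, (mem_maps.1 f.2).1 x (mem_univ x)⟩,
        (hQ _).2 fun x y => (mem_maps.1 f.2).2.2 x (mem_univ x) y (mem_univ y)⟩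
      left_inv := fun f => rfl
      right_inv := fun f => rfl }

lemma orderCount_eq (n : ℕ) : orderCount P n = #(maps 0 (univ : Finset P) n) :=
  natCard_eq_card_maps 0 n _ fun _ => monotone_iff_forall_lt

lemma strictCount_eq (n : ℕ) : strictCount P n = #(maps 1 (univ : Finset P) n) :=
  natCard_eq_card_maps 1 n _ fun _ => Iff.rfl

end OrderPoly

/-- **Reciprocity Relation.** `Ω(P, X) = (−1)^{|P|} Ω̄(P, −X)`. -/
theorem orderPoly_reciprocity (P : Type*) [Fintype P] [PartialOrder P]
    (p q : Polynomial ℚ) (hp : IsOrderPoly P p) (hq : IsStrictOrderPoly P q) :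
    p = (-1 : ℚ) ^ (Fintype.card P) • q.comp (-Polynomial.X) := by
  classical
  choose r hr using OrderPoly.exists_poly_card_maps (P := P)
  have hpr : p = r Finset.univ := OrderPoly.eq_of_eval_natCast_succ fun n => by
    have h := hp (n + 1) n.succ_pos
    rw [OrderPoly.orderCount_eq, ← hr] at h
    exact_mod_cast h
  have hcomp : p.comp (-Polynomial.X) = (-1 : ℚ) ^ Fintype.card P • q :=
    OrderPoly.eq_of_eval_natCast_succ fun n => by
      have h := OrderPoly.eval_neg_eq_card_maps hr (n + 1) Finset.univ
      rw [← OrderPoly.strictCount_eq, ← hq (n + 1) n.succ_pos, ← hpr, Finset.card_univ] at h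
      push_cast at h
      simpa [Polynomial.eval_comp] using h
  rw [← Polynomial.smul_comp, ← hcomp, Polynomial.comp_assoc]
  simp
end

section
/- Let P be a nonempty finite poset. If q ∈ ℚ[X] is a strict order polynomial of P, then q(0) = 0. -/
/-- Number of surjective strictly order-preserving maps `P → Fin n`. -/
noncomputable def surjStrictCount (P : Type*) [PartialOrder P] (n : ℕ) : ℕ :=
  Nat.card {f : P → Fin n // StrictMono f ∧ Function.Surjective f}

/-- Every strictly order-preserving map factors uniquely as a surjective one followed by the
increasing enumeration of its range. -/
theorem bijective_orderEmbOfFin_comp (P : Type*) [Fintype P] [PartialOrder P] (n : ℕ) :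
    Function.Bijective
      (fun x : (Σ S : Finset (Fin n),
          {g : P → Fin S.card // StrictMono g ∧ Function.Surjective g}) =>
        (⟨fun a => x.1.orderEmbOfFin rfl (x.2.1 a),
          (x.1.orderEmbOfFin rfl).strictMono.comp x.2.2.1⟩ : {f : P → Fin n // StrictMono f})) := by
  constructor
  · rintro ⟨S, g, hg, hg'⟩ ⟨T, k, hk, hk'⟩ h
    have h' : (fun a => S.orderEmbOfFin rfl (g a)) = fun a => T.orderEmbOfFin rfl (k a) :=
      congrArg Subtype.val h
    obtain rfl : S = T := by
      have hr := congrArg Set.range h'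
      change Set.range (S.orderEmbOfFin rfl ∘ g) = Set.range (T.orderEmbOfFin rfl ∘ k) at hr
      rw [hg'.range_comp, hk'.range_comp, Finset.range_orderEmbOfFin,
        Finset.range_orderEmbOfFin] at hr
      exact_mod_cast hr
    obtain rfl : g = k := funext fun a => (S.orderEmbOfFin rfl).injective (congrFun h' a)
    rfl
  · rintro ⟨f, hf⟩
    let S : Finset (Fin n) := Finset.univ.image f
    have hmem (a : P) : f a ∈ S := Finset.mem_image_of_mem f (Finset.mem_univ a)
    let e := S.orderIsoOfFin rfl
    refine ⟨⟨S, fun a => e.symm ⟨f a, hmem a⟩, fun a b h => e.symm.strictMono (hf h), ?_⟩, ?_⟩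
    · intro i
      obtain ⟨a, -, ha⟩ := Finset.mem_image.1 (e i).2
      exact ⟨a, by simp [ha]⟩
    · ext a
      simp [← Finset.coe_orderIsoOfFin_apply, e]

theorem strictCount_eq_sum_choose (P : Type*) [Fintype P] [PartialOrder P] (n : ℕ) :
    strictCount P n = ∑ k ∈ Finset.range (n + 1), n.choose k * surjStrictCount P k := by
  rw [strictCount, ← Nat.card_congr (Equiv.ofBijective _ (bijective_orderEmbOfFin_comp P n)),
    Nat.card_sigma]
  simpa [surjStrictCount] using
    Finset.sum_powerset_apply_card (surjStrictCount P) (x := (Finset.univ : Finset (Fin n)))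

theorem surjStrictCount_zero (P : Type*) [PartialOrder P] [Nonempty P] :
    surjStrictCount P 0 = 0 := by
  have : IsEmpty {f : P → Fin 0 // StrictMono f ∧ Function.Surjective f} :=
    ⟨fun f => (f.1 (Classical.arbitrary P)).elim0⟩
  exact Nat.card_of_isEmpty

theorem surjStrictCount_eq_zero_of_card_lt (P : Type*) [Fintype P] [PartialOrder P] {k : ℕ}
    (hk : Fintype.card P < k) : surjStrictCount P k = 0 := by
  have : IsEmpty {f : P → Fin k // StrictMono f ∧ Function.Surjective f} :=
    ⟨fun f => by simpa [hk.not_ge] using Fintype.card_le_of_surjective f.1 f.2.2⟩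
  exact Nat.card_of_isEmpty

theorem strictCount_eq_sum_range_card (P : Type*) [Fintype P] [PartialOrder P] (n : ℕ) :
    strictCount P n =
      ∑ k ∈ Finset.range (Fintype.card P + 1), n.choose k * surjStrictCount P k := by
  rw [strictCount_eq_sum_choose]
  rcases le_total n (Fintype.card P) with h | h
  · refine Finset.sum_subset (Finset.range_mono (by omega)) fun k _ hk => ?_
    rw [Nat.choose_eq_zero_of_lt (by simpa using hk), zero_mul]
  · refine (Finset.sum_subset (Finset.range_mono (by omega)) fun k _ hk => ?_).symm
    rw [surjStrictCount_eq_zero_of_card_lt P (by simpa using hk), mul_zero]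

/-- The strict order polynomial of a nonempty finite poset vanishes
at `0`. -/
theorem strictOrderPoly_eval_zero (P : Type*) [Fintype P] [PartialOrder P] [Nonempty P]
    (q : Polynomial ℚ) (hq : IsStrictOrderPoly P q) :
    q.eval 0 = 0 := by
  let r : Polynomial ℚ := ∑ k ∈ Finset.range (Fintype.card P + 1),
    Polynomial.C ((surjStrictCount P k : ℚ) / k.factorial) * descPochhammer ℚ k
  have hr (n : ℕ) : r.eval (n : ℚ) = strictCount P n := by
    rw [strictCount_eq_sum_range_card, Polynomial.eval_finsetSum]
    push_cast
    refine Finset.sum_congr rfl fun k _ => ?_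
    have : (k.factorial : ℚ) ≠ 0 := by positivity
    rw [Polynomial.eval_mul, Polynomial.eval_C, descPochhammer_eval_eq_descFactorial,
      Nat.descFactorial_eq_factorial_mul_choose]
    push_cast
    field_simp
  have hqr : q = r := by
    refine Polynomial.eq_of_infinite_eval_eq q r
      (((Set.Ioi_infinite 0).image Nat.cast_injective.injOn).mono ?_)
    rintro _ ⟨n, hn, rfl⟩
    exact (hq n hn).trans (hr n).symm
  have h0 := hr 0
  rw [strictCount_eq_sum_choose] at h0
  simpa [hqr, surjStrictCount_zero] using h0
end

section
/- Let P be a finite poset and let B_+(P) := WithBot P be the poset obtained from P by adjoining a new least element (the root). If q ∈ ℚ[X] is a strict order polynomial of B_+(P) and q' ∈ ℚ[X] is a strict order polynomial of P, then q(X+1) − q(X) = q'(X) as polynomials, i.e., Δ Ω̄(B_+(P), s) = Ω̄(P, s). -/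
/-- The map out of `WithBot P` sending the root to `0` and `a : P` to `h a + 1`. -/
def rootExtension {P : Type*} {n : ℕ} (h : P → Fin n) : WithBot P → Fin (n + 1) :=
  fun x => WithBot.recBotCoe 0 (fun a => (h a).succ) x

theorem StrictMono.rootExtension {P : Type*} [PartialOrder P] {n : ℕ} {h : P → Fin n}
    (hh : StrictMono h) : StrictMono (rootExtension h) := by
  intro x y hxy
  induction y with
  | bot => exact absurd hxy not_lt_bot
  | coe b =>
    induction x with
    | bot => exact Fin.succ_pos _
    | coe a => exact Fin.succ_lt_succ_iff.2 (hh (WithBot.coe_lt_coe.1 hxy))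

/-- A strictly monotone map into `Fin (n + 1)` avoiding `0` is the shift of one into `Fin n`. -/
theorem StrictMono.exists_eq_succ {P : Type*} [Preorder P] {n : ℕ} {f : P → Fin (n + 1)}
    (hf : StrictMono f) (h0 : ∀ x, f x ≠ 0) :
    ∃ g : P → Fin n, StrictMono g ∧ ∀ x, (g x).succ = f x :=
  ⟨fun x => (f x).pred (h0 x), fun _ _ hxy => Fin.pred_lt_pred_iff.2 (hf hxy),
    fun x => Fin.succ_pred _ (h0 x)⟩

theorem strictCount_withBot_succ (P : Type*) [Finite P] [PartialOrder P] (n : ℕ) :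
    strictCount (WithBot P) (n + 1) = strictCount (WithBot P) n + strictCount P n := by
  have : Finite (WithBot P) := inferInstanceAs (Finite (Option P))
  unfold strictCount
  rw [← Nat.card_sum]
  symm
  refine Nat.card_eq_of_bijective
    (Sum.elim (fun g => ⟨fun x => (g.1 x).succ, fun _ _ hxy => Fin.succ_lt_succ_iff.2 (g.2 hxy)⟩)
      (fun h => ⟨rootExtension h.1, h.2.rootExtension⟩)) ⟨?_, ?_⟩
  · refine Function.Injective.sumElim ?_ ?_ ?_
    · intro g g' h
      ext1
      funext x
      exact Fin.succ_injective _ (congrFun (congrArg Subtype.val h) x)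
    · intro g g' h
      ext1
      funext x
      exact Fin.succ_injective _ (congrFun (congrArg Subtype.val h) (x : WithBot P))
    · intro g h e
      exact Fin.succ_ne_zero _ (congrFun (congrArg Subtype.val e) ⊥)
  · rintro ⟨f, hf⟩
    by_cases h0 : f ⊥ = 0
    · obtain ⟨h, hh, hs⟩ := StrictMono.exists_eq_succ (f := fun a : P => f a)
        (fun _ _ hab => hf (WithBot.coe_lt_coe.2 hab))
        (fun a => Fin.pos_iff_ne_zero.1 (h0 ▸ hf (WithBot.bot_lt_coe a)))
      refine ⟨Sum.inr ⟨h, hh⟩, Subtype.ext (funext fun x => ?_)⟩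
      induction x with
      | bot => exact h0.symm
      | coe a => exact hs a
    · obtain ⟨g, hg, hs⟩ := hf.exists_eq_succ fun x =>
        Fin.pos_iff_ne_zero.1 ((Fin.pos_iff_ne_zero.2 h0).trans_le (hf.monotone bot_le))
      exact ⟨Sum.inl ⟨g, hg⟩, Subtype.ext (funext hs)⟩

/-- For `B₊(P) = WithBot P` (a new least element, the root, adjoined),
`Δ Ω̄(B₊(P), X) = Ω̄(P, X)`, i.e. `q(X+1) − q(X) = q'(X)`. -/
theorem strictOrderPoly_withBot_delta (P : Type*) [Fintype P] [PartialOrder P]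
    (q q' : Polynomial ℚ) (hq : IsStrictOrderPoly (WithBot P) q)
    (hq' : IsStrictOrderPoly P q') :
    q.comp (Polynomial.X + 1) - q = q' := by
  refine Polynomial.eq_of_infinite_eval_eq _ _ (((Set.Ioi_infinite 0).image
    (Nat.cast_injective (R := ℚ)).injOn).mono ?_)
  rintro _ ⟨n, hn, rfl⟩
  rw [Set.mem_ofPred_eq]
  have h := hq (n + 1) n.succ_pos
  rw [strictCount_withBot_succ] at h
  push_cast at h
  simp [h, hq n hn, hq' n hn]
end

section
/- Let P be a finite poset and let B_+(P) := WithBot P be the poset obtained from P by adjoining a new least element (the root). If p ∈ ℚ[X] is an order polynomial of B_+(P) and p' ∈ ℚ[X] is an order polynomial of P, then p(X) − p(X−1) = p'(X) as polynomials, i.e., ∇ Ω(B_+(P), s) = Ω(P, s). -/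
/-- The monotone maps on `WithBot P` into `Fin (n + 1)` either avoid `0`, or send `⊥` to `0`. -/
theorem orderCount_withBot_succ (P : Type*) [Finite P] [PartialOrder P] (n : ℕ) :
    orderCount (WithBot P) (n + 1) = orderCount (WithBot P) n + orderCount P (n + 1) := by
  have : Finite (WithBot P) := inferInstanceAs (Finite (Option P))
  unfold orderCount
  rw [← Nat.card_sum]
  let shift (f : {f : WithBot P → Fin n // Monotone f}) :
      {f : WithBot P → Fin (n + 1) // Monotone f} :=
    ⟨fun x => (f.1 x).succ, fun _ _ h => Fin.succ_le_succ_iff.2 (f.2 h)⟩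
  let extend (f : {f : P → Fin (n + 1) // Monotone f}) :
      {f : WithBot P → Fin (n + 1) // Monotone f} :=
    ⟨WithBot.recBotCoe 0 f.1, by
      intro a b h
      induction a with
      | bot => exact Fin.zero_le _
      | coe a =>
        induction b with
        | bot => simp at h
        | coe b => exact f.2 (WithBot.coe_le_coe.1 h)⟩
  refine (Nat.card_congr (Equiv.ofBijective (Sum.elim shift extend) ⟨?_, ?_⟩)).symm
  · refine Function.Injective.sumElim ?_ ?_ ?_
    · intro f g h
      ext1; funext x
      exact Fin.succ_injective _ (congrFun (congrArg Subtype.val h) x)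
    · intro f g h
      ext1; funext x
      exact congrFun (congrArg Subtype.val h) (x : WithBot P)
    · intro f g h
      exact Fin.succ_ne_zero _ (congrFun (congrArg Subtype.val h) ⊥)
  · rintro ⟨g, hg⟩
    by_cases h : g ⊥ = 0
    · refine ⟨.inr ⟨fun x => g x, fun a b hab => hg (WithBot.coe_le_coe.2 hab)⟩, ?_⟩
      ext1; funext x
      induction x with
      | bot => exact h.symm
      | coe x => rfl
    · have hne (x : WithBot P) : g x ≠ 0 := fun hx =>
        h (Fin.le_zero_iff.1 (hx ▸ hg bot_le))
      refine ⟨.inl ⟨fun x => (g x).pred (hne x), fun a b hab => ?_⟩, ?_⟩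
      · exact Fin.pred_le_pred_iff.2 (hg hab)
      · ext1; funext x
        exact Fin.succ_pred _ (hne x)

/-- For `B₊(P) = WithBot P` (a new least element, the root, adjoined),
`∇ Ω(B₊(P), X) = Ω(P, X)`, i.e. `p(X) − p(X−1) = p'(X)`. -/
theorem orderPoly_withBot_nabla (P : Type*) [Fintype P] [PartialOrder P]
    (p p' : Polynomial ℚ) (hp : IsOrderPoly (WithBot P) p)
    (hp' : IsOrderPoly P p') :
    p - p.comp (Polynomial.X - 1) = p' := by
  refine Polynomial.eq_of_infinite_eval_eq _ _ (Set.Infinite.mono ?_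
    (Set.infinite_range_of_injective (f := fun n : ℕ => ((n + 1 + 1 : ℕ) : ℚ))
      fun a b h => by simpa using h))
  rintro _ ⟨n, rfl⟩
  have hpred : ((n + 1 + 1 : ℕ) : ℚ) - 1 = (n + 1 : ℕ) := by push_cast; ring
  simp only [Set.mem_ofPred_eq, Polynomial.eval_sub, Polynomial.eval_comp, Polynomial.eval_X,
    Polynomial.eval_one]
  rw [hpred, hp _ (Nat.succ_pos _), hp _ (Nat.succ_pos _), hp' _ (Nat.succ_pos _),
    orderCount_withBot_succ P (n + 1)]
  push_cast
  ring
end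

section
/- For m ≥ 1, let A_m denote the m-element antichain (Fin m with the discrete partial order) and let S_m := WithBot A_m be the shrub with m leaves. Then the polynomial (B_{m+1}(X) − B_{m+1}(0))/(m+1) ∈ ℚ[X] is a strict order polynomial of S_m, where B_k denotes the k-th Bernoulli polynomial, normalized by the generating function x·e^{ux}/(e^x − 1) = 1 + Σ_{k≥1} B_k(u) x^k/k! (so B_1(u) = u − 1/2); that is, for every positive integer n, the number of strictly order-preserving maps S_m → Fin n equals (B_{m+1}(n) − B_{m+1}(0))/(m+1). -/
/-- The `m`-element antichain: `Fin m` with the discrete partial order. -/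
def DiscreteFin (m : ℕ) : Type := Fin m

instance (m : ℕ) : PartialOrder (DiscreteFin m) where
  le a b := a = b
  le_refl _ := rfl
  le_trans _ _ _ h1 h2 := Eq.trans h1 h2
  le_antisymm _ _ h _ := h

instance (m : ℕ) : Fintype (DiscreteFin m) := inferInstanceAs (Fintype (Fin m))

/-- When `A` is an antichain, a strictly monotone map out of `WithBot A` amounts to a value at `⊥`
together with an arbitrary map from `A` to the strictly larger elements. -/
def strictMonoWithBotEquiv {A β : Type*} [PartialOrder A] [Preorder β]
    (hA : ∀ a b : A, ¬ a < b) :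
    {f : WithBot A → β // StrictMono f} ≃ Σ i : β, (A → Set.Ioi i) where
  toFun f := ⟨f.1 ⊥, fun a => ⟨f.1 a, (WithBot.strictMono_iff.1 f.2).2 a⟩⟩
  invFun g := ⟨fun x : WithBot A => WithBot.recBotCoe (C := fun _ => β) g.1 (fun a => (g.2 a : β)) x,
    WithBot.strictMono_iff.2 ⟨fun a b h => (hA a b h).elim, fun a => (g.2 a).2⟩⟩
  left_inv f := by
    ext x
    cases x <;> rfl
  right_inv _ := rfl

theorem strictCount_withBot {A : Type*} [PartialOrder A] [Fintype A]
    (hA : ∀ a b : A, ¬ a < b) (n : ℕ) :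
    strictCount (WithBot A) n = ∑ k ∈ Finset.range n, k ^ Fintype.card A := by
  classical
  rw [strictCount, Nat.card_congr (strictMonoWithBotEquiv hA), Nat.card_eq_fintype_card,
    Fintype.card_sigma, ← Finset.sum_range_reflect, Finset.sum_range]
  simp

/-- The polynomial `(B_{m+1}(X) − B_{m+1}(0))/(m+1)` is a strict order
polynomial of the shrub `S_m = WithBot (A_m)`, where `B_k` is the `k`-th Bernoulli
polynomial (with `B_1(u) = u − 1/2`, Mathlib's `Polynomial.bernoulli`). -/
theorem shrub_strictOrderPoly (m : ℕ) (hm : 1 ≤ m) :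
    IsStrictOrderPoly (WithBot (DiscreteFin m))
      (((m : ℚ) + 1)⁻¹ •
        (Polynomial.bernoulli (m + 1) - Polynomial.C ((Polynomial.bernoulli (m + 1)).eval 0))) := by
  intro n _
  have hcard : Fintype.card (DiscreteFin m) = m := Fintype.card_fin m
  have hanti : ∀ a b : DiscreteFin m, ¬ a < b := fun a b h => h.ne h.le
  have hm' : (m : ℚ) + 1 ≠ 0 := by positivity
  have hsum := Polynomial.sum_range_pow_eq_bernoulli_sub n m
  rw [strictCount_withBot hanti, hcard, Polynomial.eval_smul, Polynomial.eval_sub,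
    Polynomial.eval_C, Polynomial.bernoulli_eval_zero, ← Nat.succ_eq_add_one, ← hsum,
    smul_eq_mul, inv_mul_cancel_left₀ hm']
  push_cast
  rfl
end

section
/- For every m ≥ 0, the coefficient of X in the order polynomial of the shrub S_m := WithBot A_m (the m-element antichain A_m = Fin m with discrete order, with a new least element adjoined) equals (−1)^m b_m, where b_m is the m-th Bernoulli number defined by the generating function x/(e^x − 1) = Σ_{k≥0} b_k x^k/k! (so b_0 = 1, b_1 = −1/2). (In the paper's notation: θ_{B_+(S_m)} = (−1)^m b_m.) -/
/-- A monotone map out of `WithBot (DiscreteFin m)` is a value at `⊥` together with arbitrary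
larger values at the other elements. -/
def monotoneShrubEquiv (m n : ℕ) :
    {f : WithBot (DiscreteFin m) → Fin n // Monotone f} ≃
      (i : Fin n) × (DiscreteFin m → Set.Ici i) where
  toFun f := ⟨f.1 ⊥, fun a => ⟨f.1 a, f.2 bot_le⟩⟩
  invFun g := ⟨fun x => WithBot.recBotCoe g.1 (fun a => (g.2 a : Fin n)) x, by
    intro x y hxy
    induction x using WithBot.recBotCoe with
    | bot =>
      induction y using WithBot.recBotCoe with
      | bot => exact le_rfl
      | coe b => exact (g.2 b).2
    | coe a =>
      induction y using WithBot.recBotCoe with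
      | bot => exact absurd hxy (WithBot.not_coe_le_bot a)
      | coe b =>
        obtain rfl : a = b := WithBot.coe_le_coe.mp hxy
        exact le_rfl⟩
  left_inv f := by
    apply Subtype.ext
    funext x
    induction x using WithBot.recBotCoe <;> rfl
  right_inv _ := rfl

theorem orderCount_shrub (m n : ℕ) :
    orderCount (WithBot (DiscreteFin m)) n = ∑ k ∈ Finset.Ico 1 (n + 1), k ^ m := by
  have hm : Nat.card (DiscreteFin m) = m := Nat.card_fin m
  have hi (i : Fin n) : Nat.card (DiscreteFin m → Set.Ici i) = (n - i) ^ m := by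
    rw [Nat.card_fun, hm, Nat.card_eq_fintype_card, Fintype.card_ofFinset (Finset.Ici i) fun _ => by simp,
      Fin.card_Ici]
  rw [orderCount, Nat.card_congr (monotoneShrubEquiv m n), Nat.card_sigma]
  simp_rw [hi]
  rw [Fin.sum_univ_eq_sum_range (fun i => (n - i) ^ m), ← Finset.sum_range_reflect,
    Finset.sum_Ico_eq_sum_range]
  refine Finset.sum_congr rfl fun k hk => ?_
  rw [Finset.mem_range] at hk
  congr 1
  omega

/-- The polynomial in Faulhaber's formula for `1 ^ m + ⋯ + n ^ m`. -/
noncomputable def faulhaberPoly (m : ℕ) : Polynomial ℚ :=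
  ∑ i ∈ Finset.range (m + 1),
    Polynomial.C (bernoulli' i * (m + 1).choose i / (m + 1)) * Polynomial.X ^ (m + 1 - i)

theorem eval_faulhaberPoly (m n : ℕ) :
    (faulhaberPoly m).eval (n : ℚ) = ∑ k ∈ Finset.Ico 1 (n + 1), (k : ℚ) ^ m := by
  rw [sum_Ico_pow, faulhaberPoly, Polynomial.eval_finsetSum]
  refine Finset.sum_congr rfl fun i _ => ?_
  simp only [Polynomial.eval_mul, Polynomial.eval_C, Polynomial.eval_pow, Polynomial.eval_X]
  ring

theorem coeff_one_faulhaberPoly (m : ℕ) : (faulhaberPoly m).coeff 1 = bernoulli' m := by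
  rw [faulhaberPoly, Polynomial.finsetSum_coeff, Finset.sum_eq_single_of_mem m (by simp)]
  · have h : (m : ℚ) + 1 ≠ 0 := by positivity
    simp [h]
  · intro i hi him
    rw [Finset.mem_range] at hi
    rw [Polynomial.coeff_C_mul, Polynomial.coeff_X_pow, if_neg (by omega), mul_zero]

theorem IsOrderPoly.unique {P : Type*} [PartialOrder P] {p q : Polynomial ℚ}
    (hp : IsOrderPoly P p) (hq : IsOrderPoly P q) : p = q := by
  refine Polynomial.eq_of_infinite_eval_eq p q
    (((Set.Ioi_infinite 0).image Nat.cast_injective.injOn).mono ?_)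
  rintro _ ⟨n, hn, rfl⟩
  exact (hp n hn).trans (hq n hn).symm

theorem isOrderPoly_faulhaberPoly (m : ℕ) :
    IsOrderPoly (WithBot (DiscreteFin m)) (faulhaberPoly m) := by
  intro n _
  rw [eval_faulhaberPoly, orderCount_shrub]
  push_cast
  rfl

/-- The coefficient of `X` in the order polynomial of the shrub
`S_m = WithBot (A_m)` equals `(−1)^m b_m`, with `b_m` the `m`-th Bernoulli number
(`b_1 = −1/2`, Mathlib's `bernoulli`). -/
theorem shrub_orderPoly_coeff_one (m : ℕ)
    (p : Polynomial ℚ) (hp : IsOrderPoly (WithBot (DiscreteFin m)) p) :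
    p.coeff 1 = (-1 : ℚ) ^ m * bernoulli m := by
  rw [hp.unique (isOrderPoly_faulhaberPoly m), coeff_one_faulhaberPoly, bernoulli'_eq_bernoulli]
end
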